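/- arXiv:0802.1990 — 2 statements merged into one kernel-verified Lean document; each statement's English description precedes it below -/
import Mathlib

section
/- With Ψ_n : B^{⊗(n+1)} → Ω^{(n)}_{B/A} the unique A-linear map sending y₀⊗⋯⊗yₙ to y₀ dy₁ ∧̃ ⋯ ∧̃ dyₙ, for every 1 ≤ j ≤ n, every x ∈ B^{⊗(n+1)}, and every y ∈ B: Ψ_n(x · d^{0,j}y) = (−1)^{j−1} dy ∧̃ Ψ_{n−1}(μ_{0j}(x)), where d^{0,j}y is the difference of the j-th and 0-th factor inclusions of y and μ_{0j} : B^{⊗(n+1)} → B^{⊗n} merges the 0-th and j-th factors. Consequently Ψ_n annihilates the ideal I_{0j}². -/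
open scoped TensorProduct
open PiTensorProduct

variable (A B : Type) [CommRing A] [CommRing B] [Algebra A B]

abbrev Bpow (n : ℕ) : Type := ⨂[A] (_ : Fin n), B

noncomputable def rmap {m n : ℕ} (r : Fin m → Fin n) : Bpow A B m →ₐ[A] Bpow A B n :=
  PiTensorProduct.liftAlgHom
    ((MultilinearMap.mkPiAlgebra A (Fin m) (Bpow A B n)).compLinearMap
      (fun k => (PiTensorProduct.singleAlgHom (R := A) (A := fun _ : Fin n => B) (r k)).toLinearMap))
    (by simp [← PiTensorProduct.one_def])
    (by intro x y
        simp only [MultilinearMap.compLinearMap_apply, MultilinearMap.mkPiAlgebra_apply,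
          Pi.mul_apply, AlgHom.toLinearMap_apply, _root_.map_mul, Finset.prod_mul_distrib])

noncomputable def mergeN (n i j : ℕ) (hij : i < j) (hj : j ≤ n) :
    Bpow A B (n+1) →ₐ[A] Bpow A B n :=
  rmap A B (fun k => if h1 : k.val < j then ⟨k.val, by omega⟩
    else if h2 : k.val = j then ⟨i, by omega⟩
    else ⟨k.val - 1, by have := k.isLt; omega⟩)

noncomputable def Iideal (n i j : ℕ) (hij : i < j) (hj : j ≤ n) : Ideal (Bpow A B (n+1)) :=
  RingHom.ker (mergeN A B n i j hij hj)

noncomputable def Kideal (n : ℕ) : Ideal (Bpow A B (n+1)) :=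
  ⨆ (i : ℕ) (j : ℕ) (hij : i < j) (hj : j ≤ n), (Iideal A B n i j hij hj) ^ 2

abbrev Cq (n : ℕ) : Type := Bpow A B (n+1) ⧸ Kideal A B n

noncomputable def Jt (n i j : ℕ) (hij : i < j) (hj : j ≤ n) : Ideal (Cq A B n) :=
  Ideal.map (Ideal.Quotient.mk (Kideal A B n)) (Iideal A B n i j hij hj)

noncomputable def dElt (n i j : ℕ) (hi : i ≤ n) (hj : j ≤ n) (y : B) : Bpow A B (n+1) :=
  PiTensorProduct.singleAlgHom (R := A) (A := fun _ : Fin (n+1) => B) ⟨j, by omega⟩ y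
    - PiTensorProduct.singleAlgHom (R := A) (A := fun _ : Fin (n+1) => B) ⟨i, by omega⟩ y

noncomputable def insN (n j : ℕ) (hj : j ≤ n+1) : Bpow A B (n+1) →ₐ[A] Bpow A B (n+2) :=
  rmap A B (fun k => if h : k.val < j then ⟨k.val, by omega⟩
    else ⟨k.val + 1, by have := k.isLt; omega⟩)

noncomputable def eN (n : ℕ) : Bpow A B (n+1) →ₗ[A] Bpow A B (n+2) :=
  ∑ j : Fin (n+2), ((-1 : ℤ) ^ (j : ℕ)) • (insN A B n j (by omega)).toLinearMap

noncomputable def smashG (m n N : ℕ) (h : N = m + n) (x : Bpow A B (m+1)) (y : Bpow A B (n+1)) :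
    Bpow A B (N+1) :=
  rmap A B (fun k : Fin (m+1) => (⟨k.val, by have := k.isLt; omega⟩ : Fin (N+1))) x *
  rmap A B (fun k : Fin (n+1) => (⟨m + k.val, by have := k.isLt; omega⟩ : Fin (N+1))) y

/-- The submodule of relations defining the `n`-th antisymmetric power:
generated by symmetric tensors `ω⊗τ + τ⊗ω` in adjacent slots. -/
noncomputable def symSub (n : ℕ) : Submodule B (⨂[B] (_ : Fin n), Ω[B⁄A]) :=
  Submodule.span B { x | ∃ (f : Fin n → Ω[B⁄A]) (i : Fin n) (hi : i.val + 1 < n)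
      (ω τ : Ω[B⁄A]),
    x = PiTensorProduct.tprod B
          (Function.update (Function.update f i ω) ⟨i.val+1, hi⟩ τ)
      + PiTensorProduct.tprod B
          (Function.update (Function.update f i τ) ⟨i.val+1, hi⟩ ω) }

/-- The `n`-th antisymmetric power `Ω^{(n)}_{B/A}` of the Kähler differentials. -/
abbrev ASym (n : ℕ) : Type := (⨂[B] (_ : Fin n), Ω[B⁄A]) ⧸ symSub A B n


lemma singleAlgHom_eq_tprod {m : ℕ} (k : Fin m) (b : B) :
    PiTensorProduct.singleAlgHom (R := A) (A := fun _ : Fin m => B) k b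
      = PiTensorProduct.tprod A (Pi.mulSingle k b) := rfl

lemma prod_singleAlgHom {m : ℕ} (v : Fin m → B) :
    ∏ k, PiTensorProduct.singleAlgHom (R := A) (A := fun _ : Fin m => B) k (v k)
      = PiTensorProduct.tprod A v := by
  simp only [singleAlgHom_eq_tprod, ← PiTensorProduct.tprodMonoidHom_apply]
  rw [← map_prod]
  congr 1
  exact Finset.univ_prod_mulSingle v

lemma tprod_mul_singleAlgHom {m : ℕ} (v : Fin m → B) (k : Fin m) (b : B) :
    PiTensorProduct.tprod A v
        * PiTensorProduct.singleAlgHom (R := A) (A := fun _ : Fin m => B) k b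
      = PiTensorProduct.tprod A (Function.update v k (v k * b)) := by
  rw [singleAlgHom_eq_tprod, PiTensorProduct.tprod_mul_tprod]
  congr 1
  ext i
  by_cases h : i = k
  · subst h
    simp
  · simp [h]

lemma rmap_tprod {m n : ℕ} (r : Fin m → Fin n) (v : Fin m → B) :
    rmap A B r (PiTensorProduct.tprod A v)
      = ∏ k, PiTensorProduct.singleAlgHom (R := A) (A := fun _ : Fin n => B) (r k) (v k) := by
  simp [rmap, PiTensorProduct.liftAlgHom]

lemma rmap_singleAlgHom {m n : ℕ} (r : Fin m → Fin n) (k : Fin m) (b : B) :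
    rmap A B r (PiTensorProduct.singleAlgHom (R := A) (A := fun _ : Fin m => B) k b)
      = PiTensorProduct.singleAlgHom (R := A) (A := fun _ : Fin n => B) (r k) b := by
  rw [singleAlgHom_eq_tprod, rmap_tprod, Finset.prod_eq_single k]
  · simp
  · intro i _ hi
    rw [Pi.mulSingle_eq_of_ne hi, map_one]
  · simp

lemma mergeN_tprod {n : ℕ} (p : Fin (n+1)) (h0 : 0 < p.val + 1) (hp : p.val + 1 ≤ n+1)
    (v : Fin (n+2) → B) :
    mergeN A B (n+1) 0 (p.val+1) h0 hp (PiTensorProduct.tprod A v)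
      = PiTensorProduct.tprod A (fun i => v (p.succ.succAbove i))
        * PiTensorProduct.singleAlgHom (R := A) (A := fun _ : Fin (n+1) => B) 0 (v p.succ) := by
  rw [mergeN, rmap_tprod, Fin.prod_univ_succAbove _ p.succ, mul_comm, ← prod_singleAlgHom]
  congr 1
  · refine Finset.prod_congr rfl fun i _ => ?_
    congr 2
    ext
    rcases lt_or_ge i.castSucc p.succ with h | h
    · rw [Fin.succAbove_of_castSucc_lt _ _ h]
      have : i.val < p.val + 1 := h
      simp [this]
    · rw [Fin.succAbove_of_le_castSucc _ _ h]
      have : p.val + 1 ≤ i.val := h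
      have h1 : ¬ i.val + 1 < p.val + 1 := by omega
      have h2 : ¬ i.val + 1 = p.val + 1 := by omega
      simp only [Fin.val_succ, h1, h2, dite_false, Nat.add_sub_cancel]
  · congr 2
    ext
    simp

lemma sub_rmap_mergeN_mem_span {n : ℕ} (p : Fin (n+1)) (h0 : 0 < p.val + 1)
    (hp : p.val + 1 ≤ n+1) (x : Bpow A B (n+2)) :
    x - rmap A B p.succ.succAbove (mergeN A B (n+1) 0 (p.val+1) h0 hp x)
      ∈ Ideal.span (Set.range (dElt A B (n+1) 0 (p.val+1) (Nat.zero_le _) hp)) := by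
  induction x using PiTensorProduct.induction_on with
  | smul_tprod r v =>
    rw [map_smul, map_smul, ← smul_sub, Algebra.smul_def]
    refine Ideal.mul_mem_left _ _ ?_
    rw [mergeN_tprod, map_mul, rmap_tprod, rmap_singleAlgHom, ← prod_singleAlgHom,
      Fin.prod_univ_succAbove _ p.succ, mul_comm, ← mul_sub]
    refine Ideal.mul_mem_left _ _ (Ideal.subset_span ⟨v p.succ, ?_⟩)
    rw [Fin.succ_succAbove_zero]
    rfl
  | add x y hx hy =>
    rw [map_add, map_add, add_sub_add_comm]
    exact Ideal.add_mem _ hx hy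

lemma Iideal_le_span_dElt {n : ℕ} (p : Fin (n+1)) (h0 : 0 < p.val + 1) (hp : p.val + 1 ≤ n+1) :
    Iideal A B (n+1) 0 (p.val+1) h0 hp
      ≤ Ideal.span (Set.range (dElt A B (n+1) 0 (p.val+1) (Nat.zero_le _) hp)) := by
  intro x hx
  have h : mergeN A B (n+1) 0 (p.val+1) h0 hp x = 0 := hx
  simpa [h] using sub_rmap_mergeN_mem_span A B p h0 hp x

lemma succAbove_succ_of_ne {n : ℕ} {i k : Fin n} (h : i ≠ k) :
    k.succ.succAbove i = k.castSucc.succAbove i := by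
  rcases lt_or_gt_of_ne h with h | h
  · rw [Fin.succAbove_succ_of_le _ _ h.le, Fin.succAbove_castSucc_of_lt _ _ h]
  · rw [Fin.succAbove_castSucc_of_le _ _ h.le,
      Fin.succAbove_of_le_castSucc _ _ (Fin.succ_le_castSucc_iff.mpr h)]

lemma mk_tprod_insertNth_succ {n : ℕ} (k : Fin n) (ω : Ω[B⁄A]) (g : Fin n → Ω[B⁄A]) :
    (Submodule.Quotient.mk (PiTensorProduct.tprod B
        (Fin.insertNth (α := fun _ => Ω[B⁄A]) k.succ ω g)) : ASym A B (n+1))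
      = - Submodule.Quotient.mk (PiTensorProduct.tprod B
        (Fin.insertNth (α := fun _ => Ω[B⁄A]) k.castSucc ω g)) := by
  rw [eq_neg_iff_add_eq_zero, ← Submodule.Quotient.mk_add, Submodule.Quotient.mk_eq_zero]
  refine Submodule.subset_span ⟨Fin.insertNth (α := fun _ => Ω[B⁄A]) k.succ ω g, k.castSucc,
    by simp, g k, ω, ?_⟩
  have hk : (⟨(k.castSucc).val + 1, by simp⟩ : Fin (n+1)) = k.succ := rfl
  rw [hk]
  congr 2
  · ext i
    rcases Fin.eq_self_or_eq_succAbove k.succ i with rfl | ⟨i, rfl⟩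
    · simp
    · rw [Function.update_of_ne (Fin.succAbove_ne _ _), Fin.insertNth_apply_succAbove]
      by_cases h : i = k
      · subst h
        simp
      · rw [Function.update_of_ne, Fin.insertNth_apply_succAbove]
        rw [← Fin.succAbove_succ_self k]
        exact fun h' => h (Fin.succAbove_right_injective h')
  · ext i
    rcases Fin.eq_self_or_eq_succAbove k.succ i with rfl | ⟨i, rfl⟩
    · rw [Function.update_self, ← Fin.succAbove_castSucc_self, Fin.insertNth_apply_succAbove]
    · rw [Function.update_of_ne (Fin.succAbove_ne _ _)]
      by_cases h : i = k
      · subst h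
        simp
      · rw [Function.update_of_ne, Fin.insertNth_apply_succAbove, succAbove_succ_of_ne h,
          Fin.insertNth_apply_succAbove]
        rw [← Fin.succAbove_succ_self k]
        exact fun h' => h (Fin.succAbove_right_injective h')

lemma mk_tprod_insertNth {n : ℕ} (p : Fin (n+1)) (ω : Ω[B⁄A]) (g : Fin n → Ω[B⁄A]) :
    (Submodule.Quotient.mk (PiTensorProduct.tprod B
        (Fin.insertNth (α := fun _ => Ω[B⁄A]) p ω g)) : ASym A B (n+1))
      = ((-1 : ℤ) ^ p.val) • Submodule.Quotient.mk (PiTensorProduct.tprod B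
        (Fin.cons (α := fun _ => Ω[B⁄A]) ω g)) := by
  induction p using Fin.induction with
  | zero => simp [Fin.insertNth_zero']
  | succ k ih =>
    rw [mk_tprod_insertNth_succ, ih, Fin.val_succ, pow_succ, mul_neg_one, neg_smul]
    rfl

/-- (With paper's `n` being `n+1` here, so `1 ≤ j ≤ n+1`.)
For `Ψ` the canonical map `B^{⊗(n+2)} → Ω^{(n+1)}`, `Ψ'` the one in degree `n`, and `w`
the left wedge multiplication by a 1-form:
`Ψ(x · d^{0,j}y) = (−1)^{j−1} dy ∧̃ Ψ'(μ_{0j} x)`; consequently `Ψ` annihilates `I_{0j}²`. -/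
theorem statement9 (n j : ℕ) (hj1 : 1 ≤ j) (hj : j ≤ n+1)
    (Ψ : Bpow A B (n+2) →ₗ[A] ASym A B (n+1))
    (hΨ : ∀ y : Fin (n+2) → B,
      Ψ (PiTensorProduct.tprod A y) = Submodule.Quotient.mk
        (y 0 • PiTensorProduct.tprod B
          (fun i : Fin (n+1) => KaehlerDifferential.D A B (y i.succ))))
    (Ψ' : Bpow A B (n+1) →ₗ[A] ASym A B n)
    (hΨ' : ∀ y : Fin (n+1) → B,
      Ψ' (PiTensorProduct.tprod A y) = Submodule.Quotient.mk
        (y 0 • PiTensorProduct.tprod B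
          (fun i : Fin n => KaehlerDifferential.D A B (y i.succ))))
    (w : Ω[B⁄A] →ₗ[B] ASym A B n →ₗ[B] ASym A B (n+1))
    (hw : ∀ (ω : Ω[B⁄A]) (g : Fin n → Ω[B⁄A]),
      w ω (Submodule.Quotient.mk (PiTensorProduct.tprod B g))
        = Submodule.Quotient.mk (PiTensorProduct.tprod B (Fin.cons ω g))) :
    (∀ (x : Bpow A B (n+2)) (y : B),
      Ψ (x * dElt A B (n+1) 0 j (by omega) hj y)
        = ((-1 : ℤ) ^ (j-1)) • w (KaehlerDifferential.D A B y)
            (Ψ' (mergeN A B (n+1) 0 j (by omega) hj x))) ∧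
    (∀ z ∈ (Iideal A B (n+1) 0 j (by omega) hj) ^ 2, Ψ z = 0) := by
  obtain ⟨p, rfl⟩ : ∃ p : Fin (n+1), j = p.val + 1 := ⟨⟨j - 1, by omega⟩, by simp; omega⟩
  have wedge : ∀ (x : Bpow A B (n+2)) (y : B),
      Ψ (x * dElt A B (n+1) 0 (p.val+1) (by omega) hj y)
        = ((-1 : ℤ) ^ p.val) • w (KaehlerDifferential.D A B y)
            (Ψ' (mergeN A B (n+1) 0 (p.val+1) (by omega) hj x)) := by
    intro x y
    induction x using PiTensorProduct.induction_on with
    | smul_tprod r v =>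
      have hw' : ∀ (r : A) (u : ASym A B n), w (KaehlerDifferential.D A B y) (r • u)
          = r • w (KaehlerDifferential.D A B y) u := fun r u =>
        (w (KaehlerDifferential.D A B y)).map_smul_of_tower r u
      rw [smul_mul_assoc, map_smul, map_smul, map_smul, hw', smul_comm _ r]
      congr 1
      have hd : dElt A B (n+1) 0 (p.val+1) (by omega) hj y
        = PiTensorProduct.singleAlgHom (R := A) (A := fun _ : Fin (n+2) => B) p.succ y
          - PiTensorProduct.singleAlgHom (R := A) (A := fun _ : Fin (n+2) => B) 0 y := rfl
      set g : Fin n → Ω[B⁄A] := fun i => KaehlerDifferential.D A B (v (p.succAbove i).succ)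
        with hg
      have h1 : (fun i : Fin (n+1) => KaehlerDifferential.D A B
          (Function.update v p.succ (v p.succ * y) i.succ))
          = Function.update (fun i : Fin (n+1) => KaehlerDifferential.D A B (v i.succ)) p
            (v p.succ • KaehlerDifferential.D A B y + y • KaehlerDifferential.D A B (v p.succ)) := by
        ext i
        by_cases h : i = p
        · subst h
          simp
        · simp [h]
      have h2 : Function.update (fun i : Fin (n+1) => KaehlerDifferential.D A B (v i.succ)) p
          (KaehlerDifferential.D A B y)
          = Fin.insertNth (α := fun _ => Ω[B⁄A]) p (KaehlerDifferential.D A B y) g := by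
        rw [Fin.eq_insertNth_iff]
        refine ⟨by simp, ?_⟩
        ext i
        simp [Fin.removeNth, hg]
      have h3 : Ψ (PiTensorProduct.tprod A v * dElt A B (n+1) 0 (p.val+1) (by omega) hj y)
          = (v 0 * v p.succ) • Submodule.Quotient.mk (PiTensorProduct.tprod B
            (Fin.insertNth (α := fun _ => Ω[B⁄A]) p (KaehlerDifferential.D A B y) g)) := by
        rw [hd, mul_sub, tprod_mul_singleAlgHom, tprod_mul_singleAlgHom, map_sub, hΨ, hΨ, h1,
          MultilinearMap.map_update_add, MultilinearMap.map_update_smul,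
          MultilinearMap.map_update_smul, h2, Function.update_eq_self,
          ← Submodule.Quotient.mk_sub, ← Submodule.Quotient.mk_smul]
        congr 1
        rw [Function.update_of_ne (Fin.succ_ne_zero p).symm, Function.update_self, smul_add,
          smul_smul, smul_smul]
        simp
      have h4 : Ψ' (mergeN A B (n+1) 0 (p.val+1) (by omega) hj (PiTensorProduct.tprod A v))
          = (v 0 * v p.succ) • Submodule.Quotient.mk (PiTensorProduct.tprod B g) := by
        rw [mergeN_tprod, tprod_mul_singleAlgHom, hΨ', ← Submodule.Quotient.mk_smul]
        have e0 : v (p.succ.succAbove 0) = v 0 := congrArg v (Fin.succ_succAbove_zero p)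
        have e1 (i : Fin n) : v (p.succ.succAbove i.succ) = v (p.succAbove i).succ :=
          congrArg v (Fin.succ_succAbove_succ p i)
        simp [hg, e0, e1]
      rw [h3, h4, map_smul, hw, mk_tprod_insertNth, smul_comm]
    | add x₁ x₂ h₁ h₂ =>
      rw [add_mul, map_add, h₁, h₂, map_add, map_add, map_add]
      exact (zsmul_add _ _ _).symm
  refine ⟨wedge, fun z hz => ?_⟩
  rw [pow_two] at hz
  induction hz using Submodule.mul_induction_on' with
  | mem_mul_mem a ha b hb =>
    have hb' := Iideal_le_span_dElt A B p (by omega) hj hb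
    clear hb
    induction hb' using Submodule.span_induction generalizing a with
    | mem b hb =>
      obtain ⟨y, rfl⟩ := hb
      have ha' : mergeN A B (n+1) 0 (p.val+1) (by omega) hj a = 0 := ha
      rw [wedge, ha', map_zero, map_zero]
      exact zsmul_zero _
    | zero => rw [mul_zero, map_zero]
    | add b c _ _ hb hc => rw [mul_add, map_add, hb a ha, hc a ha, add_zero]
    | smul c b _ hb =>
      rw [smul_eq_mul, ← mul_assoc]
      exact hb (a * c) (Ideal.mul_mem_right _ _ ha)
  | add x _ y _ hx hy => rw [map_add, hx, hy, add_zero]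
end

section
/- Let A be a commutative ring with 2 invertible, B a commutative A-algebra, and C_n = B^{⊗(n+1)}/(∑_{i<j} I_{ij}²) with ideals J̃_{ij}. Then the following five ideals of C_n coincide: ∏_{j=1}^n J̃_{j−1,j}, ⋂_{j=1}^n J̃_{j−1,j}, ∏_{j=1}^n J̃_{0j}, ⋂_{j=1}^n J̃_{0j}, and ⋂_{0≤i<j≤n} J̃_{ij}; and this common ideal, as a B-module via the 0-th factor, is isomorphic to the n-th exterior power Λⁿ Ω¹_{B/A}. -/
open scoped TensorProduct
open PiTensorProduct

variable (A B : Type) [CommRing A] [CommRing B] [Algebra A B]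

/-- The wedge `dy₁ ∧ ⋯ ∧ dyₙ`-style elements of the `n`-th exterior power. -/
noncomputable def wedgeD (n : ℕ) (f : Fin n → Ω[B⁄A]) : ⋀[B]^n (Ω[B⁄A]) :=
  ⟨ExteriorAlgebra.ιMulti B n f, ExteriorAlgebra.ιMulti_range B n (Set.mem_range_self f)⟩

/-- `B`-algebra structure on `C_n` through the 0-th tensor factor. -/
noncomputable instance instAlgebraBCq (n : ℕ) : Algebra B (Cq A B n) :=
  ((Ideal.Quotient.mk (Kideal A B n)).comp
    (PiTensorProduct.singleAlgHom (R := A) (A := fun _ : Fin (n+1) => B) 0).toRingHom).toAlgebra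


section Generators

variable {A B}

/-- The inclusion of `B` as the `k`-th tensor factor. -/
noncomputable abbrev factorHom {n : ℕ} (k : Fin n) : B →ₐ[A] Bpow A B n :=
  PiTensorProduct.singleAlgHom (R := A) (A := fun _ : Fin n => B) k

theorem tprod_eq_prod_factorHom {n : ℕ} (f : Fin n → B) :
    PiTensorProduct.tprod A f = ∏ k, factorHom (A := A) k (f k) := by
  have h : (f : Fin n → B) = ∏ k, Pi.mulSingle k (f k) := (Finset.univ_prod_mulSingle f).symm
  conv_lhs => rw [h]
  rw [PiTensorProduct.tprod_prod]
  rfl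

theorem tprod_mul_factorHom {n : ℕ} (f : Fin n → B) (k : Fin n) (b : B) :
    PiTensorProduct.tprod A f * factorHom (A := A) k b = PiTensorProduct.tprod A (Function.update f k (f k * b)) := by
  change PiTensorProduct.tprod A f * PiTensorProduct.tprod A (Pi.mulSingle k b) = _
  rw [PiTensorProduct.tprod_mul_tprod]
  congr 1
  ext l
  by_cases h : l = k
  · subst h; simp
  · simp [h]

theorem rmap_factorHom {m n : ℕ} (r : Fin m → Fin n) (k : Fin m) (b : B) :
    rmap A B r (factorHom k b) = factorHom (A := A) (r k) b := by
  change PiTensorProduct.lift _ (PiTensorProduct.tprod A (Pi.mulSingle (M := fun _ => B) k b)) = _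
  rw [PiTensorProduct.lift.tprod]
  simp only [MultilinearMap.compLinearMap_apply, MultilinearMap.mkPiAlgebra_apply,
    AlgHom.toLinearMap_apply]
  rw [Finset.prod_eq_single k]
  · simp
  · intro l _ hl
    simp [Pi.mulSingle_eq_of_ne hl, ← PiTensorProduct.one_def]
  · simp

theorem rmap_rmap {l m n : ℕ} (r : Fin m → Fin n) (s : Fin l → Fin m) (x : Bpow A B l) :
    rmap A B r (rmap A B s x) = rmap A B (r ∘ s) x := by
  suffices h : (rmap A B r).comp (rmap A B s) = rmap A B (r ∘ s) from DFunLike.congr_fun h x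
  refine PiTensorProduct.algHom_ext fun k => ?_
  ext b
  have := rmap_factorHom (A := A) s k b
  have h2 := rmap_factorHom (A := A) (r ∘ s) k b
  have h3 := rmap_factorHom (A := A) r (s k) b
  simp_all

variable (A) in
/-- The difference of `b` placed in the factors `j` and `i`. -/
noncomputable def factorDiff {n : ℕ} (i j : Fin n) (b : B) : Bpow A B n :=
  factorHom j b - factorHom i b

variable (A B) in
/-- The ideal identifying the factors `i` and `j`. -/
noncomputable def diagIdeal {n : ℕ} (i j : Fin n) : Ideal (Bpow A B n) :=
  Ideal.span (Set.range (factorDiff A i j))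

theorem factorDiff_mem {n : ℕ} (i j : Fin n) (b : B) : factorDiff A i j b ∈ diagIdeal A B i j :=
  Ideal.subset_span ⟨b, rfl⟩

theorem rmap_factorDiff {m n : ℕ} (r : Fin m → Fin n) (i j : Fin m) (b : B) :
    rmap A B r (factorDiff A i j b) = factorDiff A (r i) (r j) b := by
  simp only [factorDiff, map_sub, rmap_factorHom]

theorem factorDiff_self {n : ℕ} (i : Fin n) (b : B) : factorDiff A i i b = 0 := sub_self _

theorem diagIdeal_self {n : ℕ} (i : Fin n) : diagIdeal A B i i = ⊥ := by
  rw [diagIdeal, Ideal.span_eq_bot]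
  rintro _ ⟨b, rfl⟩
  exact factorDiff_self i b

theorem diagIdeal_comm {n : ℕ} (i j : Fin n) : diagIdeal A B i j = diagIdeal A B j i := by
  suffices h : ∀ i j : Fin n, diagIdeal A B i j ≤ diagIdeal A B j i from le_antisymm (h i j) (h j i)
  intro i j
  refine Ideal.span_le.2 ?_
  rintro _ ⟨b, rfl⟩
  have : factorDiff A i j b = - factorDiff A j i b := by simp [factorDiff]
  rw [this]
  exact neg_mem (factorDiff_mem j i b)

theorem map_rmap_diagIdeal_le {m n : ℕ} (r : Fin m → Fin n) (i j : Fin m) :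
    (diagIdeal A B i j).map (rmap A B r) ≤ diagIdeal A B (r i) (r j) := by
  rw [diagIdeal, Ideal.map_span, Ideal.span_le]
  rintro _ ⟨_, ⟨b, rfl⟩, rfl⟩
  rw [rmap_factorDiff]
  exact factorDiff_mem _ _ b

theorem rmap_update_tprod {n : ℕ} (i j : Fin n) (f : Fin n → B) :
    rmap A B (Function.update id j i) (PiTensorProduct.tprod A f)
      = PiTensorProduct.tprod A (Function.update f j 1) * factorHom i (f j) := by
  rw [tprod_eq_prod_factorHom, tprod_eq_prod_factorHom, map_prod,
    ← Finset.prod_erase_mul _ _ (Finset.mem_univ j),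
    ← Finset.prod_erase_mul _ (fun k => factorHom k (Function.update f j 1 k)) (Finset.mem_univ j),
    Function.update_self, map_one, mul_one, rmap_factorHom, Function.update_self]
  congr 1
  refine Finset.prod_congr rfl fun k hk => ?_
  have hkj := Finset.ne_of_mem_erase hk
  rw [rmap_factorHom, Function.update_of_ne hkj, Function.update_of_ne hkj, id]

theorem sub_rmap_update_mem {n : ℕ} (i j : Fin n) (x : Bpow A B n) :
    x - rmap A B (Function.update id j i) x ∈ diagIdeal A B i j := by
  induction x using PiTensorProduct.induction_on with
  | smul_tprod a f =>
    rw [map_smul, ← smul_sub, rmap_update_tprod]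
    refine Submodule.smul_of_tower_mem _ a ?_
    have h := tprod_mul_factorHom (A := A) (Function.update f j 1) j (f j)
    rw [Function.update_self, one_mul, Function.update_idem, Function.update_eq_self] at h
    rw [← h, ← mul_sub]
    exact Ideal.mul_mem_left _ _ (factorDiff_mem i j (f j))
  | add x y hx hy =>
    rw [map_add, add_sub_add_comm]
    exact add_mem hx hy

theorem Iideal_eq_diagIdeal (n i j : ℕ) (hij : i < j) (hj : j ≤ n) :
    Iideal A B n i j hij hj = diagIdeal A B ⟨i, by omega⟩ ⟨j, by omega⟩ := by
  apply le_antisymm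
  · intro x hx
    have h := sub_rmap_update_mem (⟨i, by omega⟩ : Fin (n + 1)) ⟨j, by omega⟩ x
    have hx' : mergeN A B n i j hij hj x = 0 := hx
    have h0 : rmap A B (fun k : Fin n => if k.val < j then k.castSucc else k.succ)
        (mergeN A B n i j hij hj x) = 0 := by rw [hx', map_zero]
    rw [mergeN, rmap_rmap] at h0
    convert h using 1
    rw [eq_comm, sub_eq_self, ← h0]
    congr 2
    funext k
    ext
    simp only [Function.update_apply, Function.comp, id, Fin.ext_iff]
    have := k.isLt
    split_ifs <;> simp_all <;> omega
  · refine Ideal.span_le.2 ?_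
    rintro _ ⟨b, rfl⟩
    change rmap A B _ _ = 0
    rw [rmap_factorDiff]
    simp [hij, factorDiff_self]

theorem diagIdeal_sq_le (n : ℕ) (i j : Fin (n + 1)) : diagIdeal A B i j ^ 2 ≤ Kideal A B n := by
  rcases lt_trichotomy i j with h | rfl | h
  · refine le_trans (le_of_eq ?_) <| le_iSup_of_le i.val <| le_iSup_of_le j.val <|
      le_iSup_of_le h <| le_iSup_of_le (by omega) le_rfl
    rw [Iideal_eq_diagIdeal]
  · rw [diagIdeal_self, Ideal.bot_pow two_ne_zero]
    exact bot_le
  · refine le_trans (le_of_eq ?_) <| le_iSup_of_le j.val <| le_iSup_of_le i.val <|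
      le_iSup_of_le h <| le_iSup_of_le (by omega) le_rfl
    rw [Iideal_eq_diagIdeal, diagIdeal_comm]

theorem Kideal_le_iff (n : ℕ) (I : Ideal (Bpow A B (n + 1))) :
    Kideal A B n ≤ I ↔ ∀ i j : Fin (n + 1), i < j → diagIdeal A B i j ^ 2 ≤ I := by
  refine ⟨fun h i j _ => (diagIdeal_sq_le n i j).trans h, fun h => ?_⟩
  refine iSup_le fun i => iSup_le fun j => iSup_le fun hij => iSup_le fun hj => ?_
  rw [Iideal_eq_diagIdeal]
  exact h _ _ hij

theorem rmap_mem_Kideal {m n : ℕ} (r : Fin (m + 1) → Fin (n + 1)) {x : Bpow A B (m + 1)}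
    (hx : x ∈ Kideal A B m) : rmap A B r x ∈ Kideal A B n := by
  suffices h : Kideal A B m ≤ (Kideal A B n).comap (rmap A B r) from h hx
  refine (Kideal_le_iff m _).2 fun i j _ => ?_
  rw [← Ideal.map_le_iff_le_comap, Ideal.map_pow]
  exact (Ideal.pow_right_mono (map_rmap_diagIdeal_le r i j) 2).trans (diagIdeal_sq_le n _ _)

/-- The pure tensors whose factors `1, …, m` have been replaced by differences along `p`. -/
noncomputable def partialDiff {n : ℕ} (p : Fin (n + 1) → Fin (n + 1)) (m : ℕ)
    (f : Fin (n + 1) → B) : Bpow A B (n + 1) :=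
  ∏ k, if k ≠ 0 ∧ k.val ≤ m then factorDiff A (p k) k (f k) else factorHom k (f k)

theorem partialDiff_zero {n : ℕ} (p : Fin (n + 1) → Fin (n + 1)) (f : Fin (n + 1) → B) :
    partialDiff p 0 f = PiTensorProduct.tprod A f := by
  rw [tprod_eq_prod_factorHom, partialDiff]
  refine Finset.prod_congr rfl fun k _ => if_neg ?_
  rintro ⟨h, h'⟩
  exact h (Fin.ext (by simpa using h'))

theorem partialDiff_sub_rmap {n : ℕ} (p : Fin (n + 1) → Fin (n + 1)) (hp : ∀ k, k ≠ 0 → p k < k)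
    (f : Fin (n + 1) → B) (m : ℕ) (hm : m < n) :
    partialDiff (A := A) p m f
      - rmap A B (Function.update id ⟨m + 1, by omega⟩ (p ⟨m + 1, by omega⟩)) (partialDiff p m f)
      = partialDiff p (m + 1) f := by
  set j : Fin (n + 1) := ⟨m + 1, by omega⟩ with hj
  have hj0 : j ≠ 0 := by simp [hj, Fin.ext_iff]
  simp only [partialDiff, map_prod]
  rw [← Finset.mul_prod_erase _ _ (Finset.mem_univ j),
    ← Finset.mul_prod_erase _ (fun k => rmap A B _ _) (Finset.mem_univ j),
    ← Finset.mul_prod_erase (a := j) _ (fun k : Fin (n + 1) =>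
      if k ≠ 0 ∧ k.val ≤ m + 1 then _ else _) (Finset.mem_univ j)]
  have h1 : ∀ k ∈ Finset.univ.erase j, rmap A B (Function.update id j (p j))
      (if k ≠ 0 ∧ k.val ≤ m then factorDiff A (p k) k (f k) else factorHom k (f k))
      = if k ≠ 0 ∧ k.val ≤ m then factorDiff A (p k) k (f k) else factorHom k (f k) := by
    intro k hk
    have hkj := Finset.ne_of_mem_erase hk
    split_ifs with h
    · have h3 := hp k h.1
      have : p k ≠ j := by
        intro h4
        rw [h4, hj, Fin.lt_def] at h3
        simp only at h3
        omega
      rw [rmap_factorDiff, Function.update_of_ne hkj, Function.update_of_ne this, id, id]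
    · rw [rmap_factorHom, Function.update_of_ne hkj, id]
  have h2 : ∀ k ∈ Finset.univ.erase j,
      (if k ≠ 0 ∧ k.val ≤ m + 1 then factorDiff A (p k) k (f k) else factorHom k (f k))
      = if k ≠ 0 ∧ k.val ≤ m then factorDiff A (p k) k (f k) else factorHom k (f k) := by
    intro k hk
    have hkj : k.val ≠ m + 1 := fun h => Finset.ne_of_mem_erase hk (Fin.ext h)
    have : k.val ≤ m + 1 ↔ k.val ≤ m := by omega
    simp only [this]
  rw [Finset.prod_congr rfl h1, Finset.prod_congr rfl h2, ← sub_mul]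
  congr 1
  rw [if_neg (by simp [hj]), if_pos ⟨hj0, le_rfl⟩, rmap_factorHom, Function.update_self]
  rfl

theorem mem_span_partialDiff {n : ℕ} (p : Fin (n + 1) → Fin (n + 1)) (hp : ∀ k, k ≠ 0 → p k < k)
    (x : Bpow A B (n + 1)) (hx : ∀ k, k ≠ 0 → x ∈ diagIdeal A B (p k) k ⊔ Kideal A B n)
    (m : ℕ) (hm : m ≤ n) :
    x ∈ Submodule.span A (Set.range (partialDiff (A := A) p m))
      ⊔ (Kideal A B n).restrictScalars A := by
  induction m with
  | zero =>
    refine Submodule.mem_sup_left ?_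
    rw [show partialDiff p 0 = _ from funext (partialDiff_zero p), PiTensorProduct.span_tprod_eq_top]
    trivial
  | succ m ih =>
    set j : Fin (n + 1) := ⟨m + 1, by omega⟩ with hj
    have hj0 : j ≠ 0 := by simp [hj, Fin.ext_iff]
    set q := rmap A B (Function.update id j (p j)) with hq
    have hqK : ∀ y ∈ Kideal A B n, q y ∈ Kideal A B n := fun y hy => rmap_mem_Kideal _ hy
    have hqx : q x ∈ Kideal A B n := by
      obtain ⟨y, hy, z, hz, rfl⟩ := Submodule.mem_sup.1 (hx j hj0)
      have := map_rmap_diagIdeal_le (A := A) (B := B) (Function.update id j (p j)) (p j) j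
        (Ideal.mem_map_of_mem _ hy)
      rw [Function.update_self, Function.update_of_ne (hp j hj0).ne, id, diagIdeal_self] at this
      rw [map_add, hq, this, zero_add]
      exact hqK z hz
    obtain ⟨y, hy, z, hz, hyz⟩ := Submodule.mem_sup.1 (ih (by omega))
    have hx' : x = (y - q y) + (z - q z + q x) := by rw [← hyz, map_add]; abel
    rw [hx']
    refine add_mem (Submodule.mem_sup_left ?_) (Submodule.mem_sup_right ?_)
    · have : (LinearMap.id - q.toLinearMap : Bpow A B (n + 1) →ₗ[A] Bpow A B (n + 1)) y
          ∈ Submodule.map (LinearMap.id - q.toLinearMap)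
          (Submodule.span A (Set.range (partialDiff (A := A) p m))) :=
        Submodule.mem_map_of_mem hy
      refine (Submodule.map_span_le _ _ _).2 ?_ this
      rintro _ ⟨f, rfl⟩
      exact Submodule.subset_span ⟨f, (partialDiff_sub_rmap p hp f m hm).symm⟩
    · exact add_mem (sub_mem hz (hqK z hz)) hqx

theorem partialDiff_last {n : ℕ} (p : Fin (n + 1) → Fin (n + 1)) (f : Fin (n + 1) → B) :
    partialDiff (A := A) p n f
      = factorHom 0 (f 0) * ∏ k : Fin n, factorDiff A (p k.succ) k.succ (f k.succ) := by
  rw [partialDiff, Fin.prod_univ_succ, if_neg (by simp)]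
  congr 1
  refine Finset.prod_congr rfl fun k _ => if_pos ⟨Fin.succ_ne_zero k, ?_⟩
  have := k.isLt
  simp only [Fin.val_succ]
  omega

end Generators

section Quotient

variable {A B}

variable (A B) in
/-- The image in `C_n` of `b` placed in the `k`-th factor. -/
noncomputable abbrev factorCq {n : ℕ} (k : Fin (n + 1)) : B →ₐ[A] Cq A B n :=
  (Ideal.Quotient.mkₐ A (Kideal A B n)).comp (factorHom k)

variable (A B) in
/-- The image in `C_n` of the ideal identifying the factors `i` and `j`. -/
noncomputable def diagCq {n : ℕ} (i j : Fin (n + 1)) : Ideal (Cq A B n) :=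
  (diagIdeal A B i j).map (Ideal.Quotient.mk (Kideal A B n))

theorem Jt_eq_diagCq (n i j : ℕ) (hij : i < j) (hj : j ≤ n) :
    Jt A B n i j hij hj = diagCq A B ⟨i, by omega⟩ ⟨j, by omega⟩ := by
  rw [Jt, Iideal_eq_diagIdeal, diagCq]

theorem diagCq_eq_span {n : ℕ} (i j : Fin (n + 1)) :
    diagCq A B i j = Ideal.span (Set.range fun b => factorCq A B j b - factorCq A B i b) := by
  rw [diagCq, diagIdeal, Ideal.map_span, ← Set.range_comp]
  rfl

theorem factorCq_sub_mem {n : ℕ} (i j : Fin (n + 1)) (b : B) :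
    factorCq A B j b - factorCq A B i b ∈ diagCq A B i j := by
  rw [diagCq_eq_span]
  exact Ideal.subset_span ⟨b, rfl⟩

theorem factorCq_sub_mul_sub {n : ℕ} (i j : Fin (n + 1)) (a b : B) :
    (factorCq A B j a - factorCq A B i a) * (factorCq A B j b - factorCq A B i b) = 0 := by
  refine Ideal.Quotient.eq_zero_iff_mem.2
    (diagIdeal_sq_le n i j ?_ : factorDiff A i j a * factorDiff A i j b ∈ Kideal A B n)
  rw [sq]
  exact Ideal.mul_mem_mul (factorDiff_mem i j a) (factorDiff_mem i j b)

theorem diagCq_zero_mul {n : ℕ} (i j : Fin (n + 1)) :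
    diagCq A B 0 i * diagCq A B i j = diagCq A B 0 i * diagCq A B 0 j := by
  have key (a b : B) : (factorCq A B i a - factorCq A B 0 a) * (factorCq A B j b - factorCq A B i b)
      = (factorCq A B i a - factorCq A B 0 a) * (factorCq A B j b - factorCq A B 0 b) := by
    linear_combination - factorCq_sub_mul_sub (A := A) (B := B) 0 i a b
  simp only [diagCq_eq_span, Ideal.span_mul_span']
  congr 1
  ext x
  simp only [Set.mem_mul, Set.mem_range, exists_exists_eq_and, key]

theorem prod_consecutive_eq_of_mul_eq {M : Type*} [CommMonoid M] (J : ℕ → ℕ → M)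
    (h : ∀ i j, J 0 i * J i j = J 0 i * J 0 j) (n : ℕ) :
    ∏ j ∈ Finset.range n, J j (j + 1) = ∏ j ∈ Finset.range n, J 0 (j + 1) := by
  induction n with
  | zero => rfl
  | succ n ih =>
    rw [Finset.prod_range_succ, ih]
    cases n with
    | zero => simp
    | succ m =>
      rw [Finset.prod_range_succ _ (m + 1), Finset.prod_range_succ _ m, mul_assoc, h, ← mul_assoc]

theorem prod_diagCq_consecutive (n : ℕ) :
    ∏ j : Fin n, diagCq A B j.castSucc j.succ = ∏ j : Fin n, diagCq A B 0 j.succ := by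
  have h := prod_consecutive_eq_of_mul_eq
    (fun i j => diagCq A B (Fin.ofNat (n + 1) i) (Fin.ofNat (n + 1) j))
    (fun i j => diagCq_zero_mul _ _) n
  rw [← Fin.prod_univ_eq_prod_range
      (fun i => diagCq A B (Fin.ofNat (n + 1) i) (Fin.ofNat (n + 1) (i + 1))),
    ← Fin.prod_univ_eq_prod_range
      (fun i => diagCq A B (Fin.ofNat (n + 1) 0) (Fin.ofNat (n + 1) (i + 1)))] at h
  have h1 (j : Fin n) : Fin.ofNat (n + 1) (j : ℕ) = j.castSucc := by
    ext; simp
  have h2 (j : Fin n) : Fin.ofNat (n + 1) ((j : ℕ) + 1) = j.succ := by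
    ext; simp
  have h0 : Fin.ofNat (n + 1) 0 = 0 := rfl
  simpa only [h0, h1, h2] using h

theorem mem_span_of_forall_mem_diagCq {n : ℕ} (p : Fin (n + 1) → Fin (n + 1))
    (hp : ∀ k, k ≠ 0 → p k < k) (x : Cq A B n) (hx : ∀ k : Fin n, x ∈ diagCq A B (p k.succ) k.succ) :
    x ∈ Submodule.span A (Set.range fun f : Fin (n + 1) → B => factorCq A B 0 (f 0) *
      ∏ k : Fin n, (factorCq A B k.succ (f k.succ) - factorCq A B (p k.succ) (f k.succ))) := by
  obtain ⟨y, rfl⟩ := Ideal.Quotient.mk_surjective x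
  have hy := mem_span_partialDiff p hp y (fun k hk => by
    obtain ⟨l, rfl⟩ := Fin.exists_succ_eq.2 hk
    exact Ideal.mem_quotient_iff_mem_sup.1 (hx l)) n le_rfl
  obtain ⟨u, hu, v, hv, rfl⟩ := Submodule.mem_sup.1 hy
  have hv0 : Ideal.Quotient.mk (Kideal A B n) v = 0 := Ideal.Quotient.eq_zero_iff_mem.2 hv
  rw [map_add, hv0, add_zero]
  have := Submodule.mem_map_of_mem (f := (Ideal.Quotient.mkₐ A (Kideal A B n)).toLinearMap) hu
  refine (Submodule.map_span_le _ _ _).2 ?_ this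
  rintro _ ⟨f, rfl⟩
  refine Submodule.subset_span ⟨f, ?_⟩
  rw [partialDiff_last, AlgHom.toLinearMap_apply, map_mul, map_prod]
  rfl

theorem iInf_diagCq_eq_prod {n : ℕ} (p : Fin (n + 1) → Fin (n + 1))
    (hp : ∀ k, k ≠ 0 → p k < k) :
    ⨅ k : Fin n, diagCq A B (p k.succ) k.succ = ∏ k : Fin n, diagCq A B (p k.succ) k.succ := by
  refine le_antisymm (fun x hx => ?_) (le_iInf fun k => ?_)
  · rw [Submodule.mem_iInf] at hx
    have h := mem_span_of_forall_mem_diagCq p hp x hx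
    suffices h' : Submodule.span A _ ≤ Submodule.restrictScalars A
      (∏ k : Fin n, diagCq A B (p k.succ) k.succ) from h' h
    refine Submodule.span_le.2 ?_
    rintro _ ⟨f, rfl⟩
    exact Ideal.mul_mem_left _ _ (Ideal.prod_mem_prod fun k _ => factorCq_sub_mem _ _ _)
  · rw [← Finset.mul_prod_erase _ _ (Finset.mem_univ k)]
    exact Ideal.mul_le_left

theorem prod_diagCq_zero_le {n : ℕ} (i j : Fin (n + 1)) (hij : i < j) :
    ∏ k : Fin n, diagCq A B 0 k.succ ≤ diagCq A B i j := by
  obtain ⟨l, rfl⟩ := Fin.exists_succ_eq.2 (Fin.ne_zero_of_lt hij)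
  rw [← Finset.mul_prod_erase _ _ (Finset.mem_univ l)]
  refine Fin.cases (fun _ => Ideal.mul_le_left) (fun m hm => ?_) i hij
  have : m ∈ Finset.univ.erase l := by
    simp only [Finset.mem_erase, Finset.mem_univ, and_true]
    rintro rfl
    exact lt_irrefl _ hm
  rw [← Finset.mul_prod_erase _ _ this, ← mul_assoc, mul_comm (diagCq A B 0 l.succ),
    ← diagCq_zero_mul]
  exact Ideal.mul_le_left.trans Ideal.mul_le_right

theorem prod_diagCq_eq_iInf_zero (n : ℕ) :
    ∏ j : Fin n, diagCq A B 0 j.succ = ⨅ j : Fin n, diagCq A B 0 j.succ :=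
  (iInf_diagCq_eq_prod (fun _ => 0) fun _ hk => Fin.pos_of_ne_zero hk).symm

theorem prod_diagCq_eq_iInf_consecutive (n : ℕ) :
    ∏ j : Fin n, diagCq A B j.castSucc j.succ = ⨅ j : Fin n, diagCq A B j.castSucc j.succ := by
  have h := iInf_diagCq_eq_prod (A := A) (B := B) (n := n)
    (Fin.cases 0 Fin.castSucc) (fun k hk => by
      obtain ⟨l, rfl⟩ := Fin.exists_succ_eq.2 hk
      exact l.castSucc_lt_succ)
  exact h.symm

theorem iInf_diagCq_zero_eq_iInf (n : ℕ) :
    ⨅ j : Fin n, diagCq A B 0 j.succ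
      = ⨅ (i : ℕ) (j : ℕ) (hij : i < j) (hj : j ≤ n), Jt A B n i j hij hj := by
  refine le_antisymm ?_ (le_iInf fun j => ?_)
  · rw [← prod_diagCq_eq_iInf_zero]
    refine le_iInf fun i => le_iInf fun j => le_iInf fun hij => le_iInf fun hj => ?_
    rw [Jt_eq_diagCq]
    exact prod_diagCq_zero_le _ _ hij
  · refine iInf_le_of_le 0 <| iInf_le_of_le (j.val + 1) <| iInf_le_of_le (by omega) <|
      iInf_le_of_le (by omega) ?_
    rw [Jt_eq_diagCq]
    rfl

end Quotient

section ExteriorPower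

variable {A B}

instance isScalarTowerCq (n : ℕ) : IsScalarTower A B (Cq A B n) :=
  IsScalarTower.of_algebraMap_eq fun a => ((factorCq A B (0 : Fin (n + 1))).commutes a).symm

theorem smul_Cq_def {n : ℕ} (b : B) (x : Cq A B n) : b • x = factorCq A B 0 b * x :=
  Algebra.smul_def b x

variable (A B) in
/-- The derivation `b ↦ b⁽ᵏ⁾ - b⁽⁰⁾` from `B` to `C_n`. -/
noncomputable def diffCq {n : ℕ} (k : Fin (n + 1)) : Derivation A B (Cq A B n) :=
  Derivation.mk' ((factorCq A B k).toLinearMap - (factorCq A B 0).toLinearMap) fun a b => by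
    simp only [LinearMap.sub_apply, AlgHom.toLinearMap_apply, smul_Cq_def, map_mul]
    linear_combination factorCq_sub_mul_sub (A := A) (B := B) 0 k a b

variable (A B) in
/-- The `B`-linear map `Ω[B⁄A] → C_n` with `db ↦ b⁽ᵏ⁾ - b⁽⁰⁾`. -/
noncomputable def kaehlerToCq {n : ℕ} (k : Fin (n + 1)) : Ω[B⁄A] →ₗ[B] Cq A B n :=
  (diffCq A B k).liftKaehlerDifferential

theorem kaehlerToCq_D {n : ℕ} (k : Fin (n + 1)) (b : B) :
    kaehlerToCq A B k (KaehlerDifferential.D A B b) = factorCq A B k b - factorCq A B 0 b :=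
  Derivation.liftKaehlerDifferential_comp_D _ b

theorem kaehlerToCq_mem {n : ℕ} (k : Fin (n + 1)) (w : Ω[B⁄A]) :
    kaehlerToCq A B k w ∈ diagCq A B 0 k := by
  have hw : w ∈ Submodule.span B (Set.range (KaehlerDifferential.D A B)) := by
    rw [KaehlerDifferential.span_range_derivation]; trivial
  refine (Submodule.span_le (p := ((diagCq A B 0 k).restrictScalars B).comap
    (kaehlerToCq A B k))).2 ?_ hw
  rintro _ ⟨b, rfl⟩
  simp only [Submodule.comap_coe, Set.mem_preimage, kaehlerToCq_D]
  exact factorCq_sub_mem 0 k b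

theorem kaehlerToCq_mul_add_mul {n : ℕ} (i j : Fin (n + 1)) (v w : Ω[B⁄A]) :
    kaehlerToCq A B i v * kaehlerToCq A B j w + kaehlerToCq A B i w * kaehlerToCq A B j v = 0 := by
  have hB : (((LinearMap.mul B (Cq A B n)).compl₁₂ (kaehlerToCq A B i) (kaehlerToCq A B j)) +
      ((LinearMap.mul B (Cq A B n)).compl₁₂ (kaehlerToCq A B i) (kaehlerToCq A B j)).flip) = 0 := by
    refine LinearMap.ext_on_range (KaehlerDifferential.span_range_derivation A B) fun a => ?_
    refine LinearMap.ext_on_range (KaehlerDifferential.span_range_derivation A B) fun b => ?_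
    simp only [LinearMap.add_apply, LinearMap.compl₁₂_apply, LinearMap.flip_apply,
      LinearMap.mul_apply', kaehlerToCq_D, LinearMap.zero_apply]
    linear_combination factorCq_sub_mul_sub (A := A) (B := B) 0 i a b
      + factorCq_sub_mul_sub (A := A) (B := B) 0 j a b
      - factorCq_sub_mul_sub (A := A) (B := B) i j a b
  exact DFunLike.congr_fun (DFunLike.congr_fun hB v) w

theorem kaehlerToCq_mul_self (h2 : IsUnit (2 : A)) {n : ℕ} (i j : Fin (n + 1)) (w : Ω[B⁄A]) :
    kaehlerToCq A B i w * kaehlerToCq A B j w = 0 := by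
  have h := kaehlerToCq_mul_add_mul i j w w
  rw [← two_smul A] at h
  exact (h2.smul_eq_zero).1 h

variable (B) in
/-- The alternating map `(ω₁, …, ωₙ) ↦ ∏ ωₖ⁽ᵏ⁾`. -/
noncomputable def kaehlerProd (h2 : IsUnit (2 : A)) (n : ℕ) : Ω[B⁄A] [⋀^Fin n]→ₗ[B] Cq A B n where
  __ := (MultilinearMap.mkPiAlgebra B (Fin n) (Cq A B n)).compLinearMap
    fun k => kaehlerToCq A B k.succ
  map_eq_zero_of_eq' v i j hv hij := by
    change ∏ k, kaehlerToCq A B k.succ (v k) = 0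
    have hj : j ∈ Finset.univ.erase i := by simp [hij.symm]
    rw [← Finset.mul_prod_erase _ _ (Finset.mem_univ i), ← Finset.mul_prod_erase _ _ hj,
      ← mul_assoc, hv, kaehlerToCq_mul_self h2, zero_mul]

variable (B) in
/-- The `B`-linear map `⋀ⁿ Ω[B⁄A] → C_n` induced by `kaehlerProd`. -/
noncomputable def wedgeToCq (h2 : IsUnit (2 : A)) (n : ℕ) : ⋀[B]^n (Ω[B⁄A]) →ₗ[B] Cq A B n :=
  exteriorPower.alternatingMapLinearEquiv (kaehlerProd B h2 n)

theorem wedgeToCq_ιMulti (h2 : IsUnit (2 : A)) (n : ℕ) (v : Fin n → Ω[B⁄A]) :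
    wedgeToCq B h2 n (exteriorPower.ιMulti B n v) = ∏ k, kaehlerToCq A B k.succ (v k) :=
  exteriorPower.alternatingMapLinearEquiv_apply_ιMulti _ _

theorem range_wedgeToCq (h2 : IsUnit (2 : A)) (n : ℕ) :
    LinearMap.range (wedgeToCq B h2 n)
      = (⨅ j : Fin n, diagCq A B 0 j.succ).restrictScalars B := by
  apply le_antisymm
  · rw [LinearMap.range_eq_map, ← exteriorPower.ιMulti_span, Submodule.map_span_le]
    rintro _ ⟨v, rfl⟩
    rw [wedgeToCq_ιMulti, ← prod_diagCq_eq_iInf_zero]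
    exact Ideal.prod_mem_prod fun k _ => kaehlerToCq_mem _ _
  · intro x hx
    have hx' := mem_span_of_forall_mem_diagCq (fun _ => 0) (fun _ hk => Fin.pos_of_ne_zero hk) x
      (Submodule.mem_iInf _ |>.1 hx)
    suffices h : Submodule.span A _ ≤ (LinearMap.range (wedgeToCq B h2 n)).restrictScalars A
      from h hx'
    refine Submodule.span_le.2 ?_
    rintro _ ⟨f, rfl⟩
    refine ⟨f 0 • exteriorPower.ιMulti B n fun k => KaehlerDifferential.D A B (f k.succ), ?_⟩
    simp only [map_smul, wedgeToCq_ιMulti, kaehlerToCq_D, smul_Cq_def]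

end ExteriorPower

section Retraction

variable {A B}

variable (A B) in
/-- The `A`-linear map `b₀ ⊗ ⋯ ⊗ bₙ ↦ b₀ db₁ ∧ ⋯ ∧ dbₙ`. -/
noncomputable def tensorToWedge (n : ℕ) : Bpow A B (n + 1) →ₗ[A] ⋀[B]^n (Ω[B⁄A]) :=
  PiTensorProduct.lift <| LinearMap.uncurryLeft
    { toFun b := b • (((exteriorPower.ιMulti B n).toMultilinearMap.restrictScalars A).compLinearMap
        fun _ => (KaehlerDifferential.D A B).toLinearMap :
          MultilinearMap A (fun _ : Fin n => B) (⋀[B]^n (Ω[B⁄A])))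
      map_add' := fun a b => add_smul a b _
      map_smul' := fun a b => by
        ext1 v
        exact smul_assoc a b _ }

theorem tensorToWedge_tprod (n : ℕ) (f : Fin (n + 1) → B) :
    tensorToWedge A B n (PiTensorProduct.tprod A f)
      = f 0 • exteriorPower.ιMulti B n fun k => KaehlerDifferential.D A B (f k.succ) := by
  rw [tensorToWedge, PiTensorProduct.lift.tprod]
  rfl

theorem tensorToWedge_factorHom_mul (n : ℕ) (b : B) (x : Bpow A B (n + 1)) :
    tensorToWedge A B n (factorHom 0 b * x) = b • tensorToWedge A B n x := by
  induction x using PiTensorProduct.induction_on with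
  | smul_tprod a f =>
    rw [mul_smul_comm, map_smul, map_smul, smul_comm b a, mul_comm, tprod_mul_factorHom,
      tensorToWedge_tprod, tensorToWedge_tprod, Function.update_self, mul_comm, mul_smul]
    simp
  | add x y hx hy => rw [mul_add, map_add, map_add, smul_add, hx, hy]

theorem tensorToWedge_rmap_update (n : ℕ) (j : Fin n) (x : Bpow A B (n + 1)) :
    tensorToWedge A B n (rmap A B (Function.update id j.succ 0) x) = 0 := by
  induction x using PiTensorProduct.induction_on with
  | smul_tprod a f =>
    rw [map_smul, map_smul, rmap_update_tprod, mul_comm, tensorToWedge_factorHom_mul,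
      tensorToWedge_tprod, AlternatingMap.map_coord_zero _ j (by simp)]
    simp
  | add x y hx hy => rw [map_add, map_add, hx, hy, add_zero]

theorem tensorToWedge_prod_factorDiff (n : ℕ) (f : Fin n → B) :
    tensorToWedge A B n (∏ k : Fin n, factorDiff A 0 k.succ (f k))
      = exteriorPower.ιMulti B n fun k => KaehlerDifferential.D A B (f k) := by
  have h : ∀ m ≤ n, tensorToWedge A B n (partialDiff (fun _ => 0) m (Fin.cons 1 f))
      = exteriorPower.ιMulti B n fun k => KaehlerDifferential.D A B (f k) := by
    intro m hm
    induction m with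
    | zero => simp [partialDiff_zero, tensorToWedge_tprod]
    | succ m ih =>
      rw [← partialDiff_sub_rmap _ (fun _ hk => Fin.pos_of_ne_zero hk) _ _ hm, map_sub,
        ih (by omega)]
      exact sub_eq_self.2 (tensorToWedge_rmap_update n ⟨m, hm⟩ _)
  have hn := h n le_rfl
  rw [partialDiff_last, Fin.cons_zero, map_one, one_mul] at hn
  simpa using hn

theorem D_comp_succ_update_zero {n : ℕ} (f : Fin (n + 1) → B) (x : B) :
    (fun k : Fin n => KaehlerDifferential.D A B (Function.update f 0 x k.succ))
      = fun k => KaehlerDifferential.D A B (f k.succ) := by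
  funext k
  rw [Function.update_of_ne (Fin.succ_ne_zero k)]

theorem D_comp_succ_update_succ {n : ℕ} (f : Fin (n + 1) → B) (l : Fin n) (x : B) :
    (fun k : Fin n => KaehlerDifferential.D A B (Function.update f l.succ x k.succ))
      = Function.update (fun k => KaehlerDifferential.D A B (f k.succ)) l
          (KaehlerDifferential.D A B x) := by
  funext k
  by_cases h : k = l
  · subst h; simp
  · simp [h]

theorem linearMap_D_second_difference {M : Type*} [AddCommGroup M] [Module B M]
    (L : Ω[B⁄A] →ₗ[B] M) (u a b : B) :
    L (KaehlerDifferential.D A B (u * a * b)) - a • L (KaehlerDifferential.D A B (u * b))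
      - b • L (KaehlerDifferential.D A B (u * a)) + (a * b) • L (KaehlerDifferential.D A B u)
      = 0 := by
  simp only [Derivation.leibniz, map_add, map_smul, smul_add]
  module

theorem bilinMap_D_second_difference {M : Type*} [AddCommGroup M] [Module B M]
    (L : Ω[B⁄A] →ₗ[B] Ω[B⁄A] →ₗ[B] M) (hL : L.IsAlt) (u v a b : B) :
    L (KaehlerDifferential.D A B u) (KaehlerDifferential.D A B (v * a * b))
      - L (KaehlerDifferential.D A B (u * a)) (KaehlerDifferential.D A B (v * b))
      - L (KaehlerDifferential.D A B (u * b)) (KaehlerDifferential.D A B (v * a))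
      + L (KaehlerDifferential.D A B (u * a * b)) (KaehlerDifferential.D A B v) = 0 := by
  have h := hL.neg (KaehlerDifferential.D A B a) (KaehlerDifferential.D A B b)
  simp only [Derivation.leibniz, map_add, map_smul, smul_add, LinearMap.add_apply,
    LinearMap.smul_apply, ← h]
  module

/-- An alternating map as a bilinear map of two of its arguments. -/
noncomputable def AlternatingMap.toBilin {R M N ι : Type*} [CommRing R] [AddCommGroup M]
    [Module R M] [AddCommGroup N] [Module R N] [DecidableEq ι] (g : M [⋀^ι]→ₗ[R] N) (w : ι → M)
    {i j : ι} (hij : i ≠ j) : M →ₗ[R] M →ₗ[R] N :=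
  LinearMap.mk₂ R (fun x y => g (Function.update (Function.update w i x) j y))
    (fun x x' y => by simp only [Function.update_comm hij, AlternatingMap.map_update_add])
    (fun c x y => by simp only [Function.update_comm hij, AlternatingMap.map_update_smul])
    (fun x y y' => by simp only [AlternatingMap.map_update_add])
    (fun c x y => by simp only [AlternatingMap.map_update_smul])

theorem AlternatingMap.toBilin_apply {R M N ι : Type*} [CommRing R] [AddCommGroup M]
    [Module R M] [AddCommGroup N] [Module R N] [DecidableEq ι] (g : M [⋀^ι]→ₗ[R] N) (w : ι → M)
    {i j : ι} (hij : i ≠ j) (x y : M) :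
    g.toBilin w hij x y = g (Function.update (Function.update w i x) j y) := rfl

theorem AlternatingMap.toBilin_isAlt {R M N ι : Type*} [CommRing R] [AddCommGroup M]
    [Module R M] [AddCommGroup N] [Module R N] [DecidableEq ι] (g : M [⋀^ι]→ₗ[R] N) (w : ι → M)
    {i j : ι} (hij : i ≠ j) : (g.toBilin w hij).IsAlt := fun x =>
  g.map_eq_zero_of_eq _ (by simp [Function.update_of_ne hij]) hij

theorem tensorToWedge_tprod_mul (n : ℕ) (i j : Fin (n + 1)) (hij : i < j) (f : Fin (n + 1) → B)
    (a b : B) : tensorToWedge A B n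
      (PiTensorProduct.tprod A f * (factorDiff A i j a * factorDiff A i j b)) = 0 := by
  obtain ⟨j, rfl⟩ := Fin.exists_succ_eq.2 (Fin.ne_zero_of_lt hij)
  have hexp : PiTensorProduct.tprod A f * (factorDiff A i j.succ a * factorDiff A i j.succ b)
      = PiTensorProduct.tprod A f * factorHom j.succ a * factorHom j.succ b
        - PiTensorProduct.tprod A f * factorHom i a * factorHom j.succ b
        - PiTensorProduct.tprod A f * factorHom i b * factorHom j.succ a
        + PiTensorProduct.tprod A f * factorHom i a * factorHom i b := by
    simp only [factorDiff]
    ring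
  rw [hexp]
  simp only [tprod_mul_factorHom, map_add, map_sub, tensorToWedge_tprod]
  set w : Fin n → Ω[B⁄A] := fun k => KaehlerDifferential.D A B (f k.succ) with hw
  induction i using Fin.cases with
  | zero =>
    have h := linearMap_D_second_difference (A := A)
      ((exteriorPower.ιMulti B n (M := Ω[B⁄A])).toMultilinearMap.toLinearMap w j) (f j.succ) a b
    have hj : Function.update w j (KaehlerDifferential.D A B (f j.succ)) = w :=
      Function.update_eq_self j w
    simp only [MultilinearMap.toLinearMap_apply, AlternatingMap.coe_multilinearMap, hj] at h
    simp only [D_comp_succ_update_zero, D_comp_succ_update_succ, Function.update_idem,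
      Function.update_self, Function.update_of_ne (Fin.succ_ne_zero j),
      Function.update_of_ne (Fin.succ_ne_zero j).symm, ← hw]
    refine Eq.trans ?_ ((congrArg (f 0 • ·) h).trans (smul_zero _))
    module
  | succ i =>
    have hij' : i ≠ j := by rintro rfl; exact lt_irrefl _ hij
    have hs : i.succ ≠ j.succ := by simpa using hij'
    have h := bilinMap_D_second_difference (A := A) ((exteriorPower.ιMulti B n).toBilin w hij')
      (AlternatingMap.toBilin_isAlt _ w hij') (f i.succ) (f j.succ) a b
    have hi : Function.update w i (KaehlerDifferential.D A B (f i.succ)) = w :=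
      Function.update_eq_self i w
    have hj (x) : Function.update (Function.update w i x) j (KaehlerDifferential.D A B (f j.succ))
        = Function.update w i x := by
      rw [Function.update_comm hij']
      congr 1
      exact Function.update_eq_self j w
    simp only [AlternatingMap.toBilin_apply, hi, hj] at h
    simp only [D_comp_succ_update_succ, Function.update_idem,
      Function.update_self, Function.update_of_ne hs.symm,
      Function.update_of_ne (Fin.succ_ne_zero _).symm, ← hw]
    refine Eq.trans ?_ ((congrArg (f 0 • ·) h).trans (smul_zero _))
    module

theorem tensorToWedge_eq_zero (n : ℕ) (x : Bpow A B (n + 1)) (hx : x ∈ Kideal A B n) :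
    tensorToWedge A B n x = 0 := by
  let I : Ideal (Bpow A B (n + 1)) :=
    { carrier := {x | ∀ t, tensorToWedge A B n (t * x) = 0}
      add_mem' := fun hx hy t => by rw [mul_add, map_add, hx t, hy t, add_zero]
      zero_mem' := fun t => by rw [mul_zero, map_zero]
      smul_mem' := fun c x hx t => by rw [smul_eq_mul, ← mul_assoc]; exact hx _ }
  suffices h : Kideal A B n ≤ I by simpa using h hx 1
  refine (Kideal_le_iff n I).2 fun i j hij => ?_
  rw [diagIdeal, sq, Ideal.span_mul_span', Ideal.span_le]
  rintro _ ⟨_, ⟨a, rfl⟩, _, ⟨b, rfl⟩, rfl⟩ t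
  induction t using PiTensorProduct.induction_on with
  | smul_tprod c f =>
    rw [smul_mul_assoc, map_smul]
    exact (congrArg _ (tensorToWedge_tprod_mul n i j hij f a b)).trans (smul_zero c)
  | add s t hs ht => rw [add_mul, map_add, hs, ht, add_zero]

theorem wedgeToCq_injective (h2 : IsUnit (2 : A)) (n : ℕ) :
    Function.Injective (wedgeToCq B h2 n) := by
  rw [← LinearMap.ker_eq_bot, LinearMap.ker_eq_bot']
  intro w hw
  have key : ∃ y : Bpow A B (n + 1), Ideal.Quotient.mk (Kideal A B n) y = wedgeToCq B h2 n w ∧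
      tensorToWedge A B n y = w := by
    have hmem : w ∈ (⊤ : Submodule B (⋀[B]^n (Ω[B⁄A]))) := trivial
    rw [← exteriorPower.ιMulti_span_of_span B n _ (KaehlerDifferential.span_range_derivation A B)] at hmem
    clear hw
    induction hmem using Submodule.span_induction with
    | mem w h =>
      obtain ⟨v, hv, rfl⟩ := h
      choose f hf using fun k => hv ⟨k, rfl⟩
      obtain rfl : (fun k => KaehlerDifferential.D A B (f k)) = v := funext hf
      refine ⟨_, ?_, tensorToWedge_prod_factorDiff n f⟩
      rw [wedgeToCq_ιMulti, map_prod]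
      exact Finset.prod_congr rfl fun k _ => (kaehlerToCq_D k.succ (f k)).symm
    | zero => exact ⟨0, by simp, by simp⟩
    | add w w' _ _ h h' =>
      obtain ⟨y, hy, hyw⟩ := h
      obtain ⟨y', hy', hyw'⟩ := h'
      exact ⟨y + y', by rw [map_add, map_add, hy, hy'], by rw [map_add, hyw, hyw']⟩
    | smul b w _ h =>
      obtain ⟨y, hy, hyw⟩ := h
      refine ⟨factorHom 0 b * y, ?_, by rw [tensorToWedge_factorHom_mul, hyw]⟩
      rw [map_smul, smul_Cq_def, map_mul, hy]
      rfl
  obtain ⟨y, hy, rfl⟩ := key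
  exact tensorToWedge_eq_zero n y (Ideal.Quotient.eq_zero_iff_mem.1 (hy.trans hw))

end Retraction
/-- (2 invertible in `A`.)  The five ideals
`∏ J̃_{j−1,j} = ⋂ J̃_{j−1,j} = ∏ J̃_{0j} = ⋂ J̃_{0j} = ⋂_{i<j} J̃_{ij}` of `Cₙ` coincide,
and the common ideal is isomorphic as a `B`-module (via the 0-th factor) to `Λⁿ Ω¹_{B/A}`. -/
theorem statement13 (n : ℕ) (h2 : IsUnit (2 : A)) :
    (∏ j : Fin n, Jt A B n j.val (j.val+1) (by omega) (by have := j.isLt; omega))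
      = (⨅ j : Fin n, Jt A B n j.val (j.val+1) (by omega) (by have := j.isLt; omega)) ∧
    (⨅ j : Fin n, Jt A B n j.val (j.val+1) (by omega) (by have := j.isLt; omega))
      = (∏ j : Fin n, Jt A B n 0 (j.val+1) (by omega) (by have := j.isLt; omega)) ∧
    (∏ j : Fin n, Jt A B n 0 (j.val+1) (by omega) (by have := j.isLt; omega))
      = (⨅ j : Fin n, Jt A B n 0 (j.val+1) (by omega) (by have := j.isLt; omega)) ∧
    (⨅ j : Fin n, Jt A B n 0 (j.val+1) (by omega) (by have := j.isLt; omega))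
      = (⨅ (i : ℕ) (j : ℕ) (hij : i < j) (hj : j ≤ n), Jt A B n i j hij hj) ∧
    Nonempty ((Submodule.restrictScalars B
        ((⨅ (i : ℕ) (j : ℕ) (hij : i < j) (hj : j ≤ n), Jt A B n i j hij hj :
          Ideal (Cq A B n)) : Submodule (Cq A B n) (Cq A B n)))
      ≃ₗ[B] ⋀[B]^n (Ω[B⁄A])) := by
  rw [← iInf_diagCq_zero_eq_iInf]
  simp only [Jt_eq_diagCq]
  have h1 := prod_diagCq_eq_iInf_consecutive (A := A) (B := B) n
  have h2' := prod_diagCq_consecutive (A := A) (B := B) n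
  have h3 := prod_diagCq_eq_iInf_zero (A := A) (B := B) n
  refine ⟨h1, h1.symm.trans h2', h3, rfl, ⟨?_⟩⟩
  exact ((LinearEquiv.ofInjective _ (wedgeToCq_injective h2 n)).trans
    (LinearEquiv.ofEq _ _ (range_wedgeToCq h2 n))).symm
end
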